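/- Let A be an ℕ-graded K-algebra generated in degrees 0 and 1, and let R ⊆ A be a graded subalgebra such that A_0·R = R·A_0 = A. Assume moreover that A_0 is a Hopf algebra over K with comultiplication Δ(h) = h_(1) ⊗ h_(2), counit ε and bijective antipode S, that R is invariant under the right adjoint action ad_r(h)(x) = S(h_(1)) x h_(2) of A_0 on A, and that there exist finitely many elements f_1, …, f_ℓ ∈ R_1 such that R_1 is the K-span of {ad_r(h)(f_i) : h ∈ A_0, i = 1, …, ℓ}. If *₁ and *₂ are two 0-equivariant star products on A such that f_i *₁ b = f_i *₂ b for all i = 1, …, ℓ and all b ∈ R, then *₁ = *₂. -/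

import Mathlib

/-- The right adjoint action `ad_r(h)(x) = S(h₍₁₎) x h₍₂₎` of a Hopf algebra `H`
on an algebra `A`, along an algebra map `ι : H →ₐ[K] A`, packaged as a linear
map in `h`. -/
noncomputable def adrL {K A H : Type*} [CommSemiring K] [Semiring A] [Algebra K A]
    [Semiring H] [HopfAlgebra K H] (ι : H →ₐ[K] A) (x : A) : H →ₗ[K] A :=
  (TensorProduct.lift
    (LinearMap.mk₂ K
      (fun h₁ h₂ => ι (HopfAlgebra.antipode (R := K) h₁) * x * ι h₂)
      (fun m₁ m₂ n => by simp [map_add, add_mul])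
      (fun c m n => by simp [map_smul, smul_mul_assoc])
      (fun m n₁ n₂ => by simp [map_add, mul_add])
      (fun c m n => by simp [map_smul, mul_smul_comm]))) ∘ₗ
    (Coalgebra.comul (R := K))

/-- The elements `a` on which two bilinear products have the same left multiplication. -/
def leftAgreement {K A : Type*} [Field K] [Ring A] [Algebra K A]
    (star1 star2 : A →ₗ[K] A →ₗ[K] A) : Submodule K A :=
  LinearMap.ker (star1 - star2)

section LeftAgreement

variable {K A : Type*} [Field K] [Ring A] [Algebra K A] {star1 star2 : A →ₗ[K] A →ₗ[K] A}

theorem mem_leftAgreement_iff {a : A} :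
    a ∈ leftAgreement star1 star2 ↔ ∀ b, star1 a b = star2 a b := by
  simp [leftAgreement, LinearMap.ext_iff, sub_eq_zero]

theorem star_mem_leftAgreement
    (hassoc1 : ∀ a b c : A, star1 (star1 a b) c = star1 a (star1 b c))
    (hassoc2 : ∀ a b c : A, star2 (star2 a b) c = star2 a (star2 b c))
    {a b : A} (ha : a ∈ leftAgreement star1 star2) (hb : b ∈ leftAgreement star1 star2) :
    star1 a b ∈ leftAgreement star1 star2 := by
  rw [mem_leftAgreement_iff] at *
  intro c
  rw [hassoc1, hb, ha, ← hassoc2, ha]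

/-- If left multiplications agree in degrees `0` and `1` and these degrees generate `A`,
then left multiplications agree in every degree. -/
theorem grading_le_leftAgreement (𝒜 : ℕ → Submodule K A) [GradedAlgebra 𝒜]
    (hgen : Algebra.adjoin K ((𝒜 0 : Set A) ∪ (𝒜 1 : Set A)) = ⊤)
    (hassoc1 : ∀ a b c : A, star1 (star1 a b) c = star1 a (star1 b c))
    (hassoc2 : ∀ a b c : A, star2 (star2 a b) c = star2 a (star2 b c))
    (hlow1 : ∀ (m n : ℕ) (a b : A), a ∈ 𝒜 m → b ∈ 𝒜 n →
      star1 a b - a * b ∈ ⨆ k < m + n, 𝒜 k)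
    (hzero : ∀ h ∈ 𝒜 0, ∀ a, star1 h a = h * a)
    (h0 : 𝒜 0 ≤ leftAgreement star1 star2) (h1 : 𝒜 1 ≤ leftAgreement star1 star2) (n : ℕ) :
    𝒜 n ≤ leftAgreement star1 star2 := by
  induction n using Nat.strong_induction_on with
  | _ n ih =>
    have hword : ∀ w ∈ Submonoid.closure ((𝒜 0 : Set A) ∪ (𝒜 1 : Set A)),
        ∃ m, w ∈ 𝒜 m ∧ (m ≤ n → w ∈ leftAgreement star1 star2) := by
      intro w hw
      induction hw using Submonoid.closure_induction_left with
      | one =>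
        exact ⟨0, SetLike.GradedOne.one_mem, fun _ => h0 SetLike.GradedOne.one_mem⟩
      | mul_left s hs y _ hy =>
        obtain ⟨m, hym, hyB⟩ := hy
        rcases hs with hs | hs
        · refine ⟨0 + m, SetLike.mul_mem_graded hs hym, fun hmn => ?_⟩
          rw [← hzero s hs]
          exact star_mem_leftAgreement hassoc1 hassoc2 (h0 hs) (hyB (by omega))
        · refine ⟨1 + m, SetLike.mul_mem_graded hs hym, fun hmn => ?_⟩
          have hstar := star_mem_leftAgreement hassoc1 hassoc2 (h1 hs) (hyB (by omega))
          have hle : ⨆ k < 1 + m, 𝒜 k ≤ leftAgreement star1 star2 :=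
            iSup₂_le fun k hk => ih k (by omega)
          simpa using sub_mem hstar (hle (hlow1 1 m s y hs hym))
    have hproj : ∀ x : A, (DirectSum.decompose 𝒜 x n : A) ∈ leftAgreement star1 star2 := by
      intro x
      have hx : x ∈ Submodule.span K
          (Submonoid.closure ((𝒜 0 : Set A) ∪ (𝒜 1 : Set A)) : Set A) := by
        rw [← Algebra.adjoin_eq_span, hgen]
        trivial
      induction hx using Submodule.span_induction with
      | mem w hw =>
        obtain ⟨m, hwm, hwB⟩ := hword w hw
        by_cases hmn : m = n
        · subst hmn
          rw [DirectSum.decompose_of_mem_same 𝒜 hwm]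
          exact hwB le_rfl
        · rw [DirectSum.decompose_of_mem_ne 𝒜 hwm hmn]
          exact zero_mem _
      | zero => simp
      | add x y _ _ hx hy => simpa using add_mem hx hy
      | smul c x _ hx =>
        rw [DirectSum.decompose_smul]
        exact Submodule.smul_mem _ c hx
    intro x hx
    simpa only [DirectSum.decompose_of_mem_same 𝒜 hx] using hproj x

/-- Right `A₀`-equivariance extends agreement from `R` to `R·A₀`. -/
theorem mem_leftAgreement_of_agree_on (A₀ : Submodule K A) (R : Subalgebra K A)
    (hRA0 : Submodule.span K {x : A | ∃ r ∈ R, ∃ h ∈ A₀, x = r * h} = ⊤)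
    (hassoc1 : ∀ a b c : A, star1 (star1 a b) c = star1 a (star1 b c))
    (hassoc2 : ∀ a b c : A, star2 (star2 a b) c = star2 a (star2 b c))
    (hr1 : ∀ h ∈ A₀, ∀ a, star1 a h = a * h) (hr2 : ∀ h ∈ A₀, ∀ a, star2 a h = a * h)
    {a : A} (ha : ∀ b ∈ R, star1 a b = star2 a b) : a ∈ leftAgreement star1 star2 := by
  rw [mem_leftAgreement_iff]
  intro b
  have hb : b ∈ Submodule.span K {x : A | ∃ r ∈ R, ∃ h ∈ A₀, x = r * h} := hRA0 ▸ trivial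
  refine LinearMap.eqOn_span (f := star1 a) (g := star2 a) ?_ hb
  rintro _ ⟨r, hr, h, hh, rfl⟩
  have e1 : star1 a (r * h) = star1 a r * h := by rw [← hr1 h hh r, ← hassoc1, hr1 h hh]
  have e2 : star2 a (r * h) = star2 a r * h := by rw [← hr2 h hh r, ← hassoc2, hr2 h hh]
  rw [e1, e2, ha r hr]

/-- The left agreement submodule is stable under the right adjoint action, provided it contains
the image of the Hopf algebra. -/
theorem adrL_mem_leftAgreement {H : Type*} [Ring H] [HopfAlgebra K H] (ι : H →ₐ[K] A)
    (hassoc1 : ∀ a b c : A, star1 (star1 a b) c = star1 a (star1 b c))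
    (hassoc2 : ∀ a b c : A, star2 (star2 a b) c = star2 a (star2 b c))
    (hl : ∀ h a, star1 (ι h) a = ι h * a) (hr : ∀ h a, star1 a (ι h) = a * ι h)
    (hι : ∀ h, ι h ∈ leftAgreement star1 star2)
    {x : A} (hx : x ∈ leftAgreement star1 star2) (h : H) :
    adrL ι x h ∈ leftAgreement star1 star2 := by
  simp only [adrL, LinearMap.comp_apply]
  induction (Coalgebra.comul (R := K) h) using TensorProduct.induction_on with
  | zero => simp
  | tmul h₁ h₂ =>
    rw [TensorProduct.lift.tmul, LinearMap.mk₂_apply, ← hl, ← hr]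
    exact star_mem_leftAgreement hassoc1 hassoc2
      (star_mem_leftAgreement hassoc1 hassoc2 (hι _) hx) (hι _)
  | add s t hs ht => simpa only [map_add] using add_mem hs ht

end LeftAgreement

/-- If `A = A₀·R` with `R` a graded subalgebra, then `Aₙ = A₀·Rₙ`. -/
theorem grading_le_span_zero_mul {K A : Type*} [Field K] [Ring A] [Algebra K A]
    (𝒜 : ℕ → Submodule K A) [GradedAlgebra 𝒜] (R : Subalgebra K A)
    (hRgraded : ∀ r ∈ R, ∀ n : ℕ, (DirectSum.decompose 𝒜 r n : A) ∈ R)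
    (hA0R : Submodule.span K {x : A | ∃ h ∈ 𝒜 0, ∃ r ∈ R, x = h * r} = ⊤) (n : ℕ) :
    𝒜 n ≤ Submodule.span K
      {x : A | ∃ h ∈ 𝒜 0, ∃ r ∈ Subalgebra.toSubmodule R ⊓ 𝒜 n, x = h * r} := by
  have hproj : ∀ x : A, (DirectSum.decompose 𝒜 x n : A) ∈ Submodule.span K
      {x : A | ∃ h ∈ 𝒜 0, ∃ r ∈ Subalgebra.toSubmodule R ⊓ 𝒜 n, x = h * r} := by
    intro x
    have hx : x ∈ Submodule.span K {x : A | ∃ h ∈ 𝒜 0, ∃ r ∈ R, x = h * r} := hA0R ▸ trivial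
    induction hx using Submodule.span_induction with
    | mem w hw =>
      obtain ⟨h, hh, r, hr, rfl⟩ := hw
      refine Submodule.subset_span
        ⟨h, hh, DirectSum.decompose 𝒜 r n, ⟨hRgraded r hr n, SetLike.coe_mem _⟩, ?_⟩
      exact DirectSum.coe_decompose_mul_of_left_mem_zero 𝒜 hh
    | zero => simp
    | add x y _ _ hx hy => simpa using add_mem hx hy
    | smul c x _ hx =>
      rw [DirectSum.decompose_smul]
      exact Submodule.smul_mem _ c hx
  intro x hx
  simpa only [DirectSum.decompose_of_mem_same 𝒜 hx] using hproj x

/-- Let `A` be an ℕ-graded `K`-algebra generated in degrees `0`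
and `1`, `R ⊆ A` a graded subalgebra with `A₀·R = R·A₀ = A`. Assume `A₀` carries
a Hopf algebra structure (realized by a Hopf algebra `H` with bijective antipode
embedded via `ι : H →ₐ[K] A` onto `A₀`, so that multiplication and unit of the
Hopf algebra are inherited from `A`), that `R` is stable under the right adjoint
action of `A₀`, and that `R₁` is spanned by the right adjoint orbits of finitely
many elements `f 0, …, f (ℓ-1) ∈ R₁`. Then two `0`-equivariant star products on
`A` agreeing on `fᵢ * b` for all `i` and all `b ∈ R` coincide. -/
theorem zero_equivariant_star_determined_by_muL_on_generators
    {K A H : Type*} [Field K] [Ring A] [Algebra K A]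
    [Ring H] [HopfAlgebra K H]
    (𝒜 : ℕ → Submodule K A) [GradedAlgebra 𝒜]
    (hgen : Algebra.adjoin K ((𝒜 0 : Set A) ∪ (𝒜 1 : Set A)) = ⊤)
    (R : Subalgebra K A)
    (hRgraded : ∀ r ∈ R, ∀ n : ℕ, (DirectSum.decompose 𝒜 r n : A) ∈ R)
    (hA0R : Submodule.span K {x : A | ∃ h ∈ 𝒜 0, ∃ r ∈ R, x = h * r} = ⊤)
    (hRA0 : Submodule.span K {x : A | ∃ r ∈ R, ∃ h ∈ 𝒜 0, x = r * h} = ⊤)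
    (ι : H →ₐ[K] A)
    (hι : Function.Injective ι)
    (hιrange : ∀ x : A, x ∈ 𝒜 0 ↔ ∃ h : H, ι h = x)
    (hS : Function.Bijective (HopfAlgebra.antipode (R := K) (A := H)))
    (hRinv : ∀ (h : H), ∀ x ∈ R, adrL ι x h ∈ R)
    (ℓ : ℕ) (f : Fin ℓ → A)
    (hfR : ∀ i, f i ∈ R) (hf1 : ∀ i, f i ∈ 𝒜 1)
    (hR1span : Subalgebra.toSubmodule R ⊓ 𝒜 1 =
      Submodule.span K {x : A | ∃ (h : H) (i : Fin ℓ), x = adrL ι (f i) h})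
    (star1 star2 : A →ₗ[K] A →ₗ[K] A)
    (hassoc1 : ∀ a b c : A, star1 (star1 a b) c = star1 a (star1 b c))
    (hassoc2 : ∀ a b c : A, star2 (star2 a b) c = star2 a (star2 b c))
    (hlow1 : ∀ (m n : ℕ) (a b : A), a ∈ 𝒜 m → b ∈ 𝒜 n →
      star1 a b - a * b ∈ ⨆ k < m + n, 𝒜 k)
    (hlow2 : ∀ (m n : ℕ) (a b : A), a ∈ 𝒜 m → b ∈ 𝒜 n →
      star2 a b - a * b ∈ ⨆ k < m + n, 𝒜 k)
    (h0eq1 : ∀ (h a : A), h ∈ 𝒜 0 → star1 a h = a * h ∧ star1 h a = h * a)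
    (h0eq2 : ∀ (h a : A), h ∈ 𝒜 0 → star2 a h = a * h ∧ star2 h a = h * a)
    (hagree : ∀ (i : Fin ℓ), ∀ b ∈ R, star1 (f i) b = star2 (f i) b) :
    star1 = star2 := by
  have h0 : 𝒜 0 ≤ leftAgreement star1 star2 := fun h hh =>
    mem_leftAgreement_iff.2 fun b => by rw [(h0eq1 h b hh).2, (h0eq2 h b hh).2]
  have hι0 : ∀ h, ι h ∈ 𝒜 0 := fun h => (hιrange _).2 ⟨h, rfl⟩
  have hf : ∀ i, f i ∈ leftAgreement star1 star2 := fun i =>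
    mem_leftAgreement_of_agree_on (𝒜 0) R hRA0 hassoc1 hassoc2
      (fun h hh a => (h0eq1 h a hh).1) (fun h hh a => (h0eq2 h a hh).1) (hagree i)
  have hR1 : Subalgebra.toSubmodule R ⊓ 𝒜 1 ≤ leftAgreement star1 star2 := by
    rw [hR1span, Submodule.span_le]
    rintro _ ⟨h, i, rfl⟩
    exact adrL_mem_leftAgreement ι hassoc1 hassoc2 (fun h a => (h0eq1 _ a (hι0 h)).2)
      (fun h a => (h0eq1 _ a (hι0 h)).1) (fun h => h0 (hι0 h)) (hf i) h
  have h1 : 𝒜 1 ≤ leftAgreement star1 star2 := by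
    refine (grading_le_span_zero_mul 𝒜 R hRgraded hA0R 1).trans (Submodule.span_le.2 ?_)
    rintro _ ⟨h, hh, r, hr, rfl⟩
    rw [← (h0eq1 h r hh).2]
    exact star_mem_leftAgreement hassoc1 hassoc2 (h0 hh) (hR1 hr)
  have htop : leftAgreement star1 star2 = ⊤ := by
    rw [eq_top_iff, ← (DirectSum.Decomposition.isInternal 𝒜).submodule_iSup_eq_top]
    exact iSup_le (grading_le_leftAgreement 𝒜 hgen hassoc1 hassoc2 hlow1
      (fun h hh a => (h0eq1 h a hh).2) h0 h1)
  exact sub_eq_zero.1 (LinearMap.ker_eq_top.1 htop)
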